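/- Let L be a first-order language, T an L-theory, and κ an infinite cardinal. Call a complete type p of T over κ 'big Henkin' if p has the Henkin property and, for all i ≠ j in κ, the sentence ¬(c_i = c_j) belongs to p. For complete types p, q of T over κ, say p ~ q if there exists a bijection ρ : κ ≃ κ such that for every L-formula φ with free variables indexed by κ, φ belongs to p if and only if the relabeled formula φ.relabel ρ belongs to q. Then the cardinality of the set of ~-equivalence classes of big Henkin complete types of T over κ equals the number of isomorphism classes of models of T of cardinality exactly κ. -/

import Mathlib

open FirstOrder Cardinal

universe u

/-- A complete type `p` of `T` over `β` has the Henkin property if, for every `L(β)`-formula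
`φ` with one free variable, whenever the sentence `∃ x, φ x` belongs to `p`, there is some
`a : β` such that the sentence `φ (c_a)` belongs to `p`. -/
def FirstOrder.Language.Theory.CompleteType.HasHenkin {L : FirstOrder.Language}
    {T : L.Theory} {β : Type*} (p : T.CompleteType β) : Prop :=
  ∀ φ : L[[β]].Formula Unit,
    (Language.BoundedFormula.relabel (fun _ => Sum.inr 0) φ).ex ∈ p →
      ∃ a : β, φ.subst (fun _ => (L.con a).term) ∈ p

/-- A complete type `p` of `T` over `β` is *big Henkin* if it has the Henkin property and
contains the sentence `¬ (c_i = c_j)` for all distinct indices `i j : β`. -/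
def FirstOrder.Language.Theory.CompleteType.BigHenkin {L : FirstOrder.Language}
    {T : L.Theory} {β : Type*} (p : T.CompleteType β) : Prop :=
  p.HasHenkin ∧
    ∀ i j : β, i ≠ j →
      (Language.Term.equal ((L.con i).term) ((L.con j).term)).not ∈ p

namespace FirstOrder.Language.Theory.CompleteType

variable {L : FirstOrder.Language.{u, u}} {T : L.Theory} {β : Type u}
  {M : Type u} [L.Structure M] [Nonempty M] [M ⊨ T]

theorem mem_typeOf_iff_realize {v : β → M} {φ : L[[β]].Sentence} :
    φ ∈ T.typeOf v ↔
      letI := constantsOn.structure v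
      φ.Realize M :=
  let := constantsOn.structure v
  mem_completeTheory

theorem ex_mem_typeOf {v : β → M} {φ : L[[β]].Formula Unit} :
    (BoundedFormula.relabel (fun _ => Sum.inr 0 : Unit → Empty ⊕ Fin 1) φ).ex ∈ T.typeOf v ↔
      letI := constantsOn.structure v
      ∃ m : M, φ.Realize fun _ => m := by
  let := constantsOn.structure v
  rw [mem_typeOf_iff_realize]
  simp only [Sentence.Realize, Formula.Realize, BoundedFormula.realize_ex,
    BoundedFormula.realize_relabel]
  refine exists_congr fun m => ?_
  convert Iff.rfl using 2
  exact funext fun _ => rfl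

theorem subst_mem_typeOf {v : β → M} {φ : L[[β]].Formula Unit} {a : β} :
    φ.subst (fun _ => (L.con a).term) ∈ T.typeOf v ↔
      letI := constantsOn.structure v
      φ.Realize fun _ => v a := by
  let := constantsOn.structure v
  rw [mem_typeOf_iff_realize]
  simp only [Sentence.Realize, Formula.Realize, BoundedFormula.realize_subst]
  rfl

theorem hasHenkin_typeOf {v : β → M} (hv : Function.Surjective v) : (T.typeOf v).HasHenkin := by
  intro φ hφ
  obtain ⟨m, hm⟩ := ex_mem_typeOf.1 hφ
  obtain ⟨a, rfl⟩ := hv m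
  exact ⟨a, subst_mem_typeOf.2 hm⟩

theorem forall_ne_not_equal_mem_typeOf_iff {v : β → M} :
    (∀ i j : β, i ≠ j →
      (Term.equal ((L.con i).term) ((L.con j).term)).not ∈ T.typeOf v) ↔
      Function.Injective v := by
  let := constantsOn.structure v
  rw [Function.injective_iff_pairwise_ne]
  refine forall_congr' fun i => forall_congr' fun j => imp_congr_right fun _ => ?_
  rw [mem_typeOf_iff_realize]
  simp only [Sentence.Realize, Formula.realize_not, Formula.realize_equal]
  rfl

theorem bigHenkin_typeOf (e : β ≃ M) : (T.typeOf e).BigHenkin :=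
  ⟨hasHenkin_typeOf e.surjective, forall_ne_not_equal_mem_typeOf_iff.2 e.injective⟩

theorem HasHenkin.meetsDefinable_range {v : β → M} (h : (T.typeOf v).HasHenkin) :
    L.MeetsDefinable (Set.range v) := by
  rintro D ⟨m, hm⟩ ⟨φ, hφ⟩
  let r : Set.range v → β := Function.surjInv Set.rangeFactorization_surjective
  have hr : v ∘ r = ((↑) : Set.range v → M) := funext fun x =>
    congrArg Subtype.val (Function.surjInv_eq Set.rangeFactorization_surjective x)
  let := constantsOn.structure v
  have : (LHom.constantsOnMap r).IsExpansionOn M := constantsOnMap_isExpansionOn hr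
  have : (L.lhomWithConstantsMap r).IsExpansionOn M := LHom.sumMap_isExpansionOn _ _ M
  let ψ : L[[β]].Formula Unit :=
    ((L.lhomWithConstantsMap r).onFormula φ).relabel fun _ => ()
  have hψ (x : M) : ψ.Realize (fun _ => x) ↔ x ∈ D := by
    rw [Formula.realize_relabel, LHom.realize_onFormula]
    exact (Set.ext_iff.1 hφ fun _ => x).symm
  obtain ⟨a, ha⟩ := h ψ (ex_mem_typeOf.2 ⟨m, (hψ m).2 hm⟩)
  exact ⟨v a, (hψ _).1 (subst_mem_typeOf.1 ha), a, rfl⟩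

theorem BigHenkin.exists_typeOf_equiv [Nonempty β] {p : T.CompleteType β}
    (hp : p.BigHenkin) :
    ∃ (M : ModelType.{u, u, u} T) (e : β ≃ M), T.typeOf e = p := by
  obtain ⟨M, v, rfl⟩ := exists_modelType_is_realized_in T p
  have hv := forall_ne_not_equal_mem_typeOf_iff.1 hp.2
  have hS := hp.1.meetsDefinable_range
  let S := hS.toElementarySubstructure
  have hSv : ∀ x, x ∈ S ↔ x ∈ Set.range v := fun x => Set.ext_iff.1 hS.closure_eq_self x
  let e : β ≃ S := (Equiv.ofInjective v hv).trans (Equiv.subtypeEquivRight fun x => (hSv x).symm)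
  have : Nonempty S := e.symm.nonempty
  have : S ⊨ T := (S.subtype.theory_model_iff T).2 M.is_model
  refine ⟨ModelType.of T S, e, SetLike.ext fun φ => ?_⟩
  rw [mem_typeOf, mem_typeOf]
  exact (S.subtype.map_formula _ e).symm

theorem exists_relabel_typeOf_iff {N : Type u} [L.Structure N] [Nonempty N] [N ⊨ T]
    (e : β ≃ M) (e' : β ≃ N) :
    (∃ ρ : β ≃ β, ∀ φ : L.Formula β, Formula.equivSentence φ ∈ T.typeOf e ↔
      Formula.equivSentence (φ.relabel ⇑ρ) ∈ T.typeOf e') ↔ Nonempty (M ≃[L] N) := by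
  simp only [formula_mem_typeOf, Formula.realize_relabel]
  constructor
  · rintro ⟨ρ, hρ⟩
    let g : M ≃ N := e.symm.trans (ρ.trans e')
    let f : M ↪ₑ[L] N :=
      { toFun := g
        map_formula' := fun n φ x => by
          have h := hρ (φ.relabel (e.symm ∘ x))
          simp only [Formula.realize_relabel] at h
          have hx : e ∘ e.symm ∘ x = x := funext fun i => e.apply_symm_apply (x i)
          rw [hx] at h
          exact h.symm }
    exact ⟨{ g with
      map_fun' := f.map_fun
      map_rel' := f.map_rel }⟩
  · rintro ⟨g⟩
    refine ⟨e.trans (g.toEquiv.trans e'.symm), fun φ => ?_⟩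
    rw [← g.toElementaryEmbedding.map_formula]
    have hg : e' ∘ e.trans (g.toEquiv.trans e'.symm) = g.toElementaryEmbedding ∘ e :=
      funext fun a => e'.apply_symm_apply (g (e a))
    rw [hg]

end FirstOrder.Language.Theory.CompleteType

theorem Cardinal.lift_mk_quot_eq.{v, w} {α : Type v} {β : Type w}
    {r : α → α → Prop} {s : β → β → Prop}
    (F : α → β) (hF : ∀ a b, r a b ↔ s (F a) (F b)) (hs : Equivalence s)
    (hsurj : ∀ b, ∃ a, s (F a) b) :
    lift.{w} #(Quot r) = lift.{v} #(Quot s) := by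
  refine mk_congr_lift (Equiv.ofBijective (Quot.map F fun a b => (hF a b).1) ⟨?_, ?_⟩)
  · rintro ⟨a⟩ ⟨b⟩ h
    exact Quot.sound ((hF a b).2 ((hs.quot_mk_eq_iff _ _).1 h))
  · rintro ⟨b⟩
    obtain ⟨a, ha⟩ := hsurj b
    exact ⟨Quot.mk _ a, Quot.sound ha⟩

theorem stmt_9 {L : FirstOrder.Language.{u, u}} (T : L.Theory) (κ : Cardinal.{u})
    (hκ : ℵ₀ ≤ κ) (β : Type u) (hβ : #β = κ) :
    Cardinal.lift.{u + 1}
      #(Quot (fun p q : { p : T.CompleteType β // p.BigHenkin } =>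
        ∃ ρ : β ≃ β, ∀ φ : L.Formula β,
          Language.Formula.equivSentence φ ∈ p.1 ↔
            Language.Formula.equivSentence (φ.relabel ⇑ρ) ∈ q.1)) =
    #(Quot (fun M N : { M : Language.Theory.ModelType.{u, u, u} T // #M.1 = κ } =>
        Nonempty (M.1 ≃[L] N.1))) := by
  have : Nonempty β := mk_ne_zero_iff.1 (hβ ▸ (aleph0_pos.trans_le hκ).ne')
  choose mod e he using fun p : { p : T.CompleteType β // p.BigHenkin } =>
    p.2.exists_typeOf_equiv
  let F (p : { p : T.CompleteType β // p.BigHenkin }) :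
      { M : Language.Theory.ModelType.{u, u, u} T // #M.1 = κ } :=
    ⟨mod p, (mk_congr (e p)).symm.trans hβ⟩
  have hF (p q : { p : T.CompleteType β // p.BigHenkin }) :
      (∃ ρ : β ≃ β, ∀ φ : L.Formula β,
        Language.Formula.equivSentence φ ∈ p.1 ↔
          Language.Formula.equivSentence (φ.relabel ⇑ρ) ∈ q.1) ↔
        Nonempty ((F p).1 ≃[L] (F q).1) := by
    rw [← Language.Theory.CompleteType.exists_relabel_typeOf_iff (T := T) (e p) (e q), he, he]
  have hequiv : Equivalence fun M N : { M : Language.Theory.ModelType.{u, u, u} T // #M.1 = κ } =>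
      Nonempty (M.1 ≃[L] N.1) :=
    ⟨fun M => ⟨.refl L M.1⟩, fun ⟨g⟩ => ⟨g.symm⟩, fun ⟨g⟩ ⟨h⟩ => ⟨h.comp g⟩⟩
  have hsurj (M : { M : Language.Theory.ModelType.{u, u, u} T // #M.1 = κ }) :
      ∃ p, Nonempty ((F p).1 ≃[L] M.1) := by
    obtain ⟨d⟩ := Cardinal.eq.1 (hβ.trans M.2.symm)
    let p : { p : T.CompleteType β // p.BigHenkin } :=
      ⟨T.typeOf d, Language.Theory.CompleteType.bigHenkin_typeOf d⟩
    refine ⟨p, (Language.Theory.CompleteType.exists_relabel_typeOf_iff (T := T) (e p) d).1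
      ⟨.refl β, fun φ => ?_⟩⟩
    rw [he p]
    simp [p]
  exact (lift_mk_quot_eq F hF hequiv hsurj).trans (lift_id'.{u, u + 1} _)
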